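/- Suppose each P_i (i = 1, …, n) is a nonempty compact convex subset of a finite-dimensional real vector space and that for every u₀ ∈ P₀, every i and every u_{−i}, the function u_i' ↦ J_i(u₀, (u_i', u_{−i})) is quasiconcave on P_i. Define K_i(u) = min_{u₀ ∈ P₀} J_i(u₀, u) for u ∈ P. Then there exists a profile u♮ ∈ P such that K_i(u♮) ≥ K_i((u_i, u♮_{−i})) for every i = 1, …, n and every u_i ∈ P_i; consequently (u₀, u♮) ∈ B for every u₀ ∈ P₀, and in particular the set B is nonempty. -/

import Mathlib

/-- A finite set `σ` is dominant for a family of rankings if no element beats, in every ranking,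
the worst element of `σ`. -/
def IsDominant {X I : Type*} (r : I → X → ℕ) (σ : Finset X) : Prop :=
  ∀ y, ∃ i, ∀ x ∈ σ, r i y ≤ r i x

theorem IsDominant.mono {X I : Type*} {r : I → X → ℕ} {σ τ : Finset X}
    (h : IsDominant r σ) (hτ : τ ⊆ σ) :
    IsDominant r τ := fun y => (h y).imp fun _ hi x hx => hi x (hτ hx)

/-- A dominant set with one element less than the number of rankings extends to exactly two
dominant sets, provided that it can be improved in all rankings but any given one. -/
theorem IsDominant.card_extensions {X I : Type*} [Fintype X] [DecidableEq X] [Fintype I]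
    [DecidableEq I] {r : I → X → ℕ} (hr : ∀ i, Function.Injective (r i))
    {τ : Finset X} (hne : τ.Nonempty) (hcard : τ.card + 1 = Fintype.card I)
    (hτ : IsDominant r τ)
    (himp : ∀ k, ∃ y, ∀ l, l ≠ k → ∃ x ∈ τ, r l x < r l y) :
    ∃ a b, a ≠ b ∧ ∀ x, (x ∉ τ ∧ IsDominant r (insert x τ)) ↔ x = a ∨ x = b := by
  choose m hmτ hm using fun i => τ.exists_min_image (r i) hne
  have hsurj : ∀ x ∈ τ, ∃ i, m i = x := by
    intro x hx
    obtain ⟨i, hi⟩ := hτ x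
    exact ⟨i, hr i (le_antisymm (hm i x hx) (hi _ (hmτ i)))⟩
  obtain ⟨i, -, j, -, hij, hmij⟩ : ∃ i ∈ (Finset.univ : Finset I), ∃ j ∈ Finset.univ,
      i ≠ j ∧ m i = m j :=
    Finset.exists_ne_map_eq_of_card_lt_of_maps_to (t := τ)
      (by rw [Finset.card_univ]; omega) (fun i _ => hmτ i)
  -- surjectivity off `k` forces injectivity off `k`
  have hinj : ∀ k, (∀ x ∈ τ, ∃ l, l ≠ k ∧ m l = x) →
      ∀ a b, a ≠ k → b ≠ k → m a = m b → a = b := by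
    intro k hk a b ha hb hab
    refine Finset.inj_on_of_surj_on_of_card_le (s := Finset.univ.erase k) (t := τ)
      (fun l _ => m l) (fun l _ => hmτ l) (fun x hx => ?_) ?_ (by simpa using ha)
      (by simpa using hb) hab
    · obtain ⟨l, hl, rfl⟩ := hk x hx
      exact ⟨l, by simpa using hl, rfl⟩
    · rw [Finset.card_erase_of_mem (Finset.mem_univ _), Finset.card_univ]; omega
  have hex : ∀ k, ∃ a, (∀ l, l ≠ k → r l (m l) < r l a) ∧
      ∀ y, (∀ l, l ≠ k → r l (m l) < r l y) → r k y ≤ r k a := by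
    intro k
    obtain ⟨a, ha, ha'⟩ := (Finset.univ.filter
      (fun y => ∀ l, l ≠ k → r l (m l) < r l y)).exists_max_image (r k) (by
        obtain ⟨y, hy⟩ := himp k
        refine ⟨y, by
          simp only [Finset.mem_filter, Finset.mem_univ, true_and]
          intro l hl
          obtain ⟨x, hx, hxy⟩ := hy l hl
          exact (hm l x hx).trans_lt hxy⟩)
    simp only [Finset.mem_filter, Finset.mem_univ, true_and] at ha ha'
    exact ⟨a, ha, ha'⟩
  have hle : ∀ k a, (∀ l, l ≠ k → r l (m l) < r l a) → r k a ≤ r k (m k) := by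
    intro k a ha
    obtain ⟨l, hl⟩ := hτ a
    by_cases hlk : l = k
    · subst hlk; exact hl _ (hmτ l)
    · exact absurd (ha l hlk) (not_lt.2 (hl _ (hmτ l)))
  have hgood : ∀ k k', k ≠ k' → m k = m k' → ∀ a, (∀ l, l ≠ k → r l (m l) < r l a) →
      (∀ y, (∀ l, l ≠ k → r l (m l) < r l y) → r k y ≤ r k a) →
      a ∉ τ ∧ IsDominant r (insert a τ) := by
    intro k k' hk hkm a ha ha'
    refine ⟨fun haτ => ?_, fun y => ?_⟩
    · obtain ⟨l, rfl⟩ := hsurj a haτ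
      by_cases hlk : l = k
      · subst hlk
        have := ha k' hk.symm
        rw [hkm] at this
        exact lt_irrefl _ this
      · exact lt_irrefl _ (ha l hlk)
    · by_cases hy : ∀ l, l ≠ k → r l (m l) < r l y
      · refine ⟨k, fun x hx => ?_⟩
        rcases Finset.mem_insert.1 hx with rfl | hx
        · exact ha' y hy
        · exact (ha' y hy).trans ((hle k a ha).trans (hm k x hx))
      · push Not at hy
        obtain ⟨l, hlk, hl⟩ := hy
        refine ⟨l, fun x hx => ?_⟩
        rcases Finset.mem_insert.1 hx with rfl | hx
        · exact hl.trans (ha l hlk).le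
        · exact hl.trans (hm l x hx)
  obtain ⟨a, ha, ha'⟩ := hex i
  obtain ⟨b, hb, hb'⟩ := hex j
  refine ⟨a, b, ?_, fun x => ⟨?_, ?_⟩⟩
  · rintro rfl
    exact absurd (ha j hij.symm) (not_lt.2 (hle j a hb))
  · rintro ⟨hxτ, hx⟩
    obtain ⟨k, hk⟩ := hx x
    have hz : ∀ z ∈ τ, ∃ l, l ≠ k ∧ m l = z ∧ r l z ≤ r l x := by
      intro z hz
      obtain ⟨l, hl⟩ := hx z
      refine ⟨l, ?_, hr l (le_antisymm (hm l z hz) (hl _ (by simp [hmτ]))), hl x (by simp)⟩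
      rintro rfl
      have := hr l (le_antisymm (hl x (by simp)) (hk z (by simp [hz])))
      exact hxτ (this ▸ hz)
    have hinjk := hinj k fun z h => (hz z h).imp fun l hl => ⟨hl.1, hl.2.1⟩
    have hkx : ∀ l, l ≠ k → r l (m l) < r l x := by
      intro l hl
      obtain ⟨l', hl', hml, hlx⟩ := hz (m l) (hmτ l)
      obtain rfl := hinjk l' l hl' hl hml
      refine lt_of_le_of_ne hlx fun h => hxτ (hr _ h ▸ hmτ _)
    have hmax : ∀ y, (∀ l, l ≠ k → r l (m l) < r l y) → r k y ≤ r k x := by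
      intro y hy
      obtain ⟨l, hl⟩ := hx y
      by_cases hlk : l = k
      · subst hlk; exact hl x (by simp)
      · exact absurd (hy l hlk) (not_lt.2 (hl _ (by simp [hmτ])))
    have hkij : k = i ∨ k = j := by
      by_contra! h
      exact hij (hinjk i j h.1.symm h.2.symm hmij)
    rcases hkij with rfl | rfl
    · exact Or.inl (hr _ (le_antisymm (ha' x hkx) (hmax a ha)))
    · exact Or.inr (hr _ (le_antisymm (hb' x hkx) (hmax b hb)))
  · rintro (rfl | rfl)
    · exact hgood i j hij hmij x ha ha'
    · exact hgood j i hij.symm hmij.symm x hb hb'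

/-- The number of facets carrying all colors but one is odd exactly for colorful sets. -/
theorem odd_card_facets_iff {X I : Type*} [DecidableEq X] [Fintype I] [DecidableEq I]
    (c : X → I) (i₀ : I) {σ : Finset X} (hσ : σ.card = Fintype.card I) :
    Odd (σ.filter fun x => (σ.erase x).image c = Finset.univ.erase i₀).card ↔
      σ.image c = Finset.univ := by
  constructor
  · intro hodd
    by_contra hc
    obtain ⟨x₀, hx₀⟩ := Finset.card_pos.1 hodd.pos
    obtain ⟨hx₀σ, hx₀c⟩ := Finset.mem_filter.1 hx₀
    have hc0 : c x₀ ≠ i₀ := by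
      intro h
      apply hc
      rw [← Finset.insert_erase hx₀σ, Finset.image_insert, hx₀c, h,
        Finset.insert_erase (Finset.mem_univ _)]
    obtain ⟨x₁, hx₁, hx₁c⟩ := Finset.mem_image.1
      (hx₀c ▸ Finset.mem_erase.2 ⟨hc0, Finset.mem_univ _⟩ : c x₀ ∈ (σ.erase x₀).image c)
    have hinj : Set.InjOn c (σ.erase x₀ : Finset X) := by
      apply Finset.injOn_of_card_image_eq
      rw [hx₀c, Finset.card_erase_of_mem hx₀σ, Finset.card_erase_of_mem (Finset.mem_univ _), hσ,
        Finset.card_univ]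
    have hx₁' := Finset.mem_erase.1 hx₁
    have : (σ.filter fun x => (σ.erase x).image c = Finset.univ.erase i₀) = {x₀, x₁} := by
      ext x
      simp only [Finset.mem_filter, Finset.mem_insert, Finset.mem_singleton]
      constructor
      · rintro ⟨hx, hxc⟩
        by_contra! hne
        have : c x ∈ (σ.erase x).image c := by
          rw [hxc, ← hx₀c]
          exact Finset.mem_image_of_mem _ (by simp [hx, hne.1])
        obtain ⟨z, hz, hzc⟩ := Finset.mem_image.1 this
        obtain ⟨hzx, hzσ⟩ := Finset.mem_erase.1 hz
        by_cases hz0 : z = x₀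
        · subst hz0
          exact hne.2 (hinj (by simp [hx, hne.1]) (by simp [hx₁'.1, hx₁'.2]) (by rw [hx₁c, hzc]))
        · exact hzx (hinj (by simp [hz0, hzσ]) (by simp [hx, hne.1]) hzc)
      · rintro (rfl | rfl)
        · exact ⟨hx₀σ, hx₀c⟩
        · refine ⟨hx₁'.2, ?_⟩
          rw [← hx₀c]
          ext k
          simp only [Finset.mem_image, Finset.mem_erase]
          constructor
          · rintro ⟨z, ⟨hz, hzσ⟩, rfl⟩
            by_cases hz0 : z = x₀
            · exact ⟨x, hx₁', by rw [hx₁c, hz0]⟩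
            · exact ⟨z, ⟨hz0, hzσ⟩, rfl⟩
          · rintro ⟨z, ⟨hz, hzσ⟩, rfl⟩
            by_cases hz0 : z = x
            · exact ⟨x₀, ⟨hx₁'.1.symm, hx₀σ⟩, by rw [hz0, hx₁c]⟩
            · exact ⟨z, ⟨hz0, hzσ⟩, rfl⟩
    rw [this, Finset.card_pair hx₁'.1.symm] at hodd
    exact absurd hodd (by decide)
  · intro hc
    have hinj : Set.InjOn c σ := by
      apply Finset.injOn_of_card_image_eq
      rw [hc, hσ, Finset.card_univ]
    obtain ⟨x₀, hx₀, rfl⟩ := Finset.mem_image.1 (hc ▸ Finset.mem_univ i₀ : i₀ ∈ σ.image c)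
    have : (σ.filter fun x => (σ.erase x).image c = Finset.univ.erase (c x₀)) = {x₀} := by
      ext x
      simp only [Finset.mem_filter, Finset.mem_singleton]
      constructor
      · rintro ⟨hx, hxc⟩
        by_contra hne
        have : c x₀ ∈ (σ.erase x).image c :=
          Finset.mem_image_of_mem _ (by simp [hx₀, Ne.symm hne])
        rw [hxc] at this
        simp at this
      · rintro rfl
        refine ⟨hx₀, ?_⟩
        rw [← hc]
        ext k
        simp only [Finset.mem_image, Finset.mem_erase]
        constructor
        · rintro ⟨z, ⟨hz, hzσ⟩, rfl⟩
          exact ⟨fun h => hz (hinj hzσ hx₀ h), z, hzσ, rfl⟩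
        · rintro ⟨hk, z, hzσ, rfl⟩
          exact ⟨z, ⟨fun h => hk (by rw [h]), hzσ⟩, rfl⟩
    rw [this]; simp

/-- The number of dominant extensions of `τ` by one element equals the number of dominant sets
with one more element containing it. -/
theorem card_dominant_supersets {X I : Type*} [Fintype X] [DecidableEq X] [Fintype I]
    {r : I → X → ℕ} {τ : Finset X} (hτ : τ.card + 1 = Fintype.card I)
    [DecidablePred (IsDominant r)] :
    (Finset.univ.filter fun σ : Finset X =>
      (σ.card = Fintype.card I ∧ IsDominant r σ) ∧ τ ⊆ σ).card =
    (Finset.univ.filter fun x : X => x ∉ τ ∧ IsDominant r (insert x τ)).card := by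
  symm
  refine Finset.card_bij (fun x _ => insert x τ) ?_ ?_ ?_
  · intro x hx
    simp only [Finset.mem_filter, Finset.mem_univ, true_and] at hx ⊢
    exact ⟨⟨by rw [Finset.card_insert_of_notMem hx.1, hτ], hx.2⟩, Finset.subset_insert _ _⟩
  · intro x hx y hy hxy
    simp only [Finset.mem_filter, Finset.mem_univ, true_and] at hx hy
    exact (Finset.insert_inj hx.1).1 hxy
  · intro σ hσ
    simp only [Finset.mem_filter, Finset.mem_univ, true_and] at hσ
    obtain ⟨⟨hc, hd⟩, hsub⟩ := hσ
    obtain ⟨x, hx, rfl⟩ := (Finset.covBy_iff_exists_insert).1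
      (Finset.covBy_iff_card_sdiff_eq_one.2 ⟨hsub, by
        rw [Finset.card_sdiff_of_subset hsub]; omega⟩)
    exact ⟨x, by simpa using ⟨hx, hd⟩, rfl⟩

/-- Scarf's lemma, in the form with one artificial element per ranking. -/
theorem exists_colorful_dominant_sum {T I : Type*} [Fintype T] [Nonempty T] [DecidableEq T]
    [Fintype I] [Nonempty I] [DecidableEq I] (R : I → T ⊕ I → ℕ)
    (hR : ∀ i, Function.Injective (R i)) (hbot : ∀ i, R i (Sum.inr i) = 0)
    (htop : ∀ i j t, j ≠ i → R i (Sum.inl t) < R i (Sum.inr j)) (c : T → I) :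
    ∃ σ : Finset (T ⊕ I), σ.card = Fintype.card I ∧ IsDominant R σ ∧
      σ.image (Sum.elim c id) = Finset.univ := by
  classical
  obtain ⟨i₀⟩ := ‹Nonempty I›
  set c' : T ⊕ I → I := Sum.elim c id with hc'
  let rooms := Finset.univ.filter fun σ : Finset (T ⊕ I) =>
    σ.card = Fintype.card I ∧ IsDominant R σ
  let doors := Finset.univ.filter fun τ : Finset (T ⊕ I) =>
    τ.card + 1 = Fintype.card I ∧ IsDominant R τ ∧ τ.image c' = Finset.univ.erase i₀
  let τ₀ : Finset (T ⊕ I) := (Finset.univ.erase i₀).image Sum.inr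
  have hIpos : 0 < Fintype.card I := Fintype.card_pos_iff.2 ⟨i₀⟩
  have hmemτ₀ : ∀ x, x ∈ τ₀ ↔ ∃ l, l ≠ i₀ ∧ Sum.inr l = x := by
    intro x; simp [τ₀]
  have hτ₀card : τ₀.card + 1 = Fintype.card I := by
    rw [Finset.card_image_of_injective _ Sum.inr_injective,
      Finset.card_erase_of_mem (Finset.mem_univ _), Finset.card_univ]
    omega
  have hτ₀dom : IsDominant R τ₀ := by
    rintro (t | l)
    · refine ⟨i₀, fun x hx => ?_⟩
      obtain ⟨l, hl, rfl⟩ := (hmemτ₀ x).1 hx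
      exact (htop _ _ _ hl).le
    · exact ⟨l, fun x _ => by rw [hbot]; exact Nat.zero_le _⟩
  have hτ₀ : τ₀ ∈ doors := by
    simp only [doors, Finset.mem_filter, Finset.mem_univ, true_and]
    refine ⟨hτ₀card, hτ₀dom, ?_⟩
    simp only [τ₀, Finset.image_image, hc', Sum.elim_comp_inr, Finset.image_id]
  have hbase : (Finset.univ.filter fun x => x ∉ τ₀ ∧ IsDominant R (insert x τ₀)).card = 1 := by
    obtain ⟨t, -, ht⟩ := (Finset.univ : Finset T).exists_max_image (fun t => R i₀ (Sum.inl t))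
      Finset.univ_nonempty
    rw [Finset.card_eq_one]
    refine ⟨Sum.inl t, ?_⟩
    ext x
    simp only [Finset.mem_filter, Finset.mem_univ, true_and, Finset.mem_singleton]
    constructor
    · rintro ⟨hx, hdom⟩
      have hpos : ∀ (k : I) (s : T), 0 < R k (Sum.inl s) := fun k s =>
        Nat.pos_of_ne_zero fun h => by
          have := hR k (h.trans (hbot k).symm)
          simp at this
      obtain ⟨i, hi⟩ := hdom (Sum.inl t)
      have hii : i = i₀ := by
        by_contra hne
        have := hi (Sum.inr i) (Finset.mem_insert_of_mem ((hmemτ₀ _).2 ⟨i, hne, rfl⟩))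
        rw [hbot] at this
        exact absurd (hpos i t) (by omega)
      subst hii
      have hxt := hi x (Finset.mem_insert_self _ _)
      rcases x with s | l
      · exact hR i (le_antisymm (ht s (Finset.mem_univ _)) hxt)
      · by_cases hl : l = i
        · subst hl
          rw [hbot] at hxt
          exact absurd (hpos l t) (by omega)
        · exact absurd ((hmemτ₀ _).2 ⟨l, hl, rfl⟩) hx
    · rintro rfl
      refine ⟨fun h => by simpa using (hmemτ₀ _).1 h, ?_⟩
      rintro (s | l)
      · refine ⟨i₀, fun x hx => ?_⟩
        rcases Finset.mem_insert.1 hx with rfl | hx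
        · exact ht s (Finset.mem_univ _)
        · obtain ⟨l, hl, rfl⟩ := (hmemτ₀ x).1 hx
          exact (htop _ _ _ hl).le
      · exact ⟨l, fun x _ => by rw [hbot]; exact Nat.zero_le _⟩
  have htwo : ∀ τ ∈ doors, τ ≠ τ₀ →
      (Finset.univ.filter fun x => x ∉ τ ∧ IsDominant R (insert x τ)).card = 2 := by
    intro τ hτ hne
    simp only [doors, Finset.mem_filter, Finset.mem_univ, true_and] at hτ
    obtain ⟨hcard, hdom, hcol⟩ := hτ
    obtain ⟨t, ht⟩ : ∃ t, Sum.inl t ∈ τ := by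
      by_contra! hno
      apply hne
      ext x
      rw [hmemτ₀]
      constructor
      · intro hx
        rcases x with t | l
        · exact absurd hx (hno t)
        · have := Finset.mem_image_of_mem c' hx
          rw [hcol] at this
          exact ⟨l, by simpa [hc'] using this, rfl⟩
      · rintro ⟨l, hl, rfl⟩
        have : l ∈ τ.image c' := by rw [hcol]; simpa using hl
        obtain ⟨x, hx, hxl⟩ := Finset.mem_image.1 this
        rcases x with t | l'
        · exact absurd hx (hno t)
        · simp only [hc', Sum.elim_inr, id] at hxl
          exact hxl ▸ hx
    obtain ⟨a, b, hab, h⟩ := hdom.card_extensions hR ⟨_, ht⟩ hcard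
      (fun k => ⟨Sum.inr k, fun l hl => ⟨_, ht, htop _ _ _ hl.symm⟩⟩)
    rw [Finset.card_eq_two]
    exact ⟨a, b, hab, by ext x; simpa using h x⟩
  have hcount := Finset.sum_card_bipartiteAbove_eq_sum_card_bipartiteBelow
    (s := doors) (t := rooms) (fun τ σ => τ ⊆ σ)
  have hup : ∀ τ ∈ doors, (Finset.bipartiteAbove (fun τ σ => τ ⊆ σ) rooms τ).card =
      (Finset.univ.filter fun x => x ∉ τ ∧ IsDominant R (insert x τ)).card := by
    intro τ hτ
    simp only [doors, Finset.mem_filter, Finset.mem_univ, true_and] at hτ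
    rw [← card_dominant_supersets hτ.1]
    simp only [Finset.bipartiteAbove, rooms, Finset.filter_filter]
  have hodd : Odd (∑ τ ∈ doors, (Finset.bipartiteAbove (fun τ σ => τ ⊆ σ) rooms τ).card) := by
    rw [Finset.odd_sum_iff_odd_card_odd]
    have : (doors.filter fun τ => Odd (Finset.bipartiteAbove (fun τ σ => τ ⊆ σ) rooms τ).card)
        = {τ₀} := by
      ext τ
      simp only [Finset.mem_filter, Finset.mem_singleton]
      constructor
      · rintro ⟨hτ, ho⟩
        by_contra hne
        rw [hup τ hτ, htwo τ hτ hne] at ho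
        exact absurd ho (by decide)
      · rintro rfl
        exact ⟨hτ₀, by rw [hup _ hτ₀, hbase]; exact odd_one⟩
    rw [this]; simp
  rw [hcount, Finset.odd_sum_iff_odd_card_odd] at hodd
  obtain ⟨σ, hσ⟩ := Finset.card_pos.1 hodd.pos
  obtain ⟨hσ, ho⟩ := Finset.mem_filter.1 hσ
  simp only [rooms, Finset.mem_filter, Finset.mem_univ, true_and] at hσ
  refine ⟨σ, hσ.1, hσ.2, (odd_card_facets_iff c' i₀ hσ.1).1 ?_⟩
  convert ho using 1
  refine Finset.card_bij (fun x _ => σ.erase x) ?_ ?_ ?_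
  · intro x hx
    obtain ⟨hxσ, hx⟩ := Finset.mem_filter.1 hx
    simp only [Finset.bipartiteBelow, doors, Finset.mem_filter, Finset.mem_univ, true_and]
    refine ⟨⟨?_, hσ.2.mono (Finset.erase_subset _ _), hx⟩, Finset.erase_subset _ _⟩
    rw [Finset.card_erase_of_mem hxσ, hσ.1]; omega
  · intro x hx y hy hxy
    exact (Finset.erase_inj σ (Finset.mem_filter.1 hx).1).1 hxy
  · intro τ hτ
    simp only [Finset.bipartiteBelow, doors, Finset.mem_filter, Finset.mem_univ, true_and] at hτ
    obtain ⟨⟨hcard, -, hcol⟩, hsub⟩ := hτ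
    obtain ⟨x, hx, rfl⟩ := (Finset.covBy_iff_exists_insert).1
      (Finset.covBy_iff_card_sdiff_eq_one.2 ⟨hsub, by
        rw [Finset.card_sdiff_of_subset hsub]; omega⟩)
    exact ⟨x, by simpa [Finset.erase_insert hx] using hcol, Finset.erase_insert hx⟩

/-- Scarf's lemma: any coloring of a finite set by the rankings admits a set of rankings which is
exactly the set of colors of a subset `σ`, and such that no element beats the worst elements of
`σ` in all those rankings. -/
theorem exists_colorful_dominant {T I : Type*} [Fintype T] [Nonempty T]
    [Fintype I] [Nonempty I] [DecidableEq I] (r : I → T → ℕ)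
    (hr : ∀ i, Function.Injective (r i)) (c : T → I) :
    ∃ σ : Finset T, ∀ y, ∃ i ∈ σ.image c, ∀ x ∈ σ, r i y ≤ r i x := by
  classical
  let B : ℕ := (∑ i, ∑ t, r i t) + 2
  have hB : ∀ i t, r i t + 1 < B := by
    intro i t
    have h1 : r i t ≤ ∑ t, r i t :=
      Finset.single_le_sum (f := fun t => r i t) (fun _ _ => Nat.zero_le _) (Finset.mem_univ t)
    have h2 : ∑ t, r i t ≤ ∑ i, ∑ t, r i t :=
      Finset.single_le_sum (f := fun i => ∑ t, r i t) (fun _ _ => Nat.zero_le _)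
        (Finset.mem_univ i)
    simp only [B]; omega
  let e := Fintype.equivFin I
  let R : I → T ⊕ I → ℕ := fun i =>
    Sum.elim (fun t => r i t + 1) (fun j => if j = i then 0 else B + e j)
  obtain ⟨σ, hcard, hdom, hcol⟩ := exists_colorful_dominant_sum R (by
    rintro i (t | j) (t' | j') h
    · simp only [R, Sum.elim_inl, Nat.add_right_cancel_iff] at h
      rw [hr i h]
    · have := hB i t
      simp only [R, Sum.elim_inl, Sum.elim_inr] at h
      split_ifs at h
      all_goals omega
    · have := hB i t'
      simp only [R, Sum.elim_inl, Sum.elim_inr] at h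
      split_ifs at h
      all_goals omega
    · simp only [R, Sum.elim_inr] at h
      split_ifs at h with h1 h2 h2
      · rw [h1, h2]
      · omega
      · omega
      · rw [e.injective (Fin.ext (Nat.add_left_cancel h))])
    (fun i => by simp [R]) (fun i j t hj => by
      have := hB i t
      simp only [R, Sum.elim_inl, Sum.elim_inr, if_neg hj]; omega) c
  have hinj : Set.InjOn (Sum.elim c id) (σ : Set (T ⊕ I)) := by
    apply Finset.injOn_of_card_image_eq
    rw [hcol, hcard, Finset.card_univ]
  refine ⟨Finset.univ.filter fun t => Sum.inl t ∈ σ, fun y => ?_⟩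
  obtain ⟨i, hi⟩ := hdom (Sum.inl y)
  refine ⟨i, ?_, fun x hx => ?_⟩
  · obtain ⟨x, hx, hxi⟩ := Finset.mem_image.1 (hcol ▸ Finset.mem_univ i :
      i ∈ σ.image (Sum.elim c id))
    rcases x with t | j
    · exact Finset.mem_image.2 ⟨t, by simpa using hx, hxi⟩
    · simp only [Sum.elim_inr, id] at hxi
      subst hxi
      have := hi _ hx
      simp [R] at this
  · have := hi (Sum.inl x) (by simpa using hx)
    simpa [R] using this

/-- For any coloring of the lattice points of a dilated simplex, there is a lattice point which is
close to a point of color `i` or to the `i`-th facet, for every `i`. -/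
theorem exists_lattice_point_near_colors {I : Type*} [Fintype I] [Nonempty I] (N : ℕ)
    (c : (I → ℕ) → I) :
    ∃ x : I → ℕ, ∑ i, x i = N ∧ ∀ i, x i ≤ Fintype.card I ∨ ∃ x' : I → ℕ, ∑ i, x' i = N ∧
      c x' = i ∧ ∀ j, x' j ≤ x j + Fintype.card I ∧ x j ≤ x' j + Fintype.card I := by
  classical
  let S : Finset (I → ℕ) := Finset.piAntidiag Finset.univ N
  have hS : ∀ x, x ∈ S ↔ ∑ i, x i = N := fun x => by simp [S, Finset.mem_piAntidiag]
  obtain ⟨i₁⟩ := ‹Nonempty I›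
  have : Nonempty S := ⟨⟨Pi.single i₁ N, (hS _).2 (by simp)⟩⟩
  let e := Fintype.equivFin S
  let r : I → S → ℕ := fun i x => x.1 i * Fintype.card S + e x
  have hr : ∀ i x y, r i y ≤ r i x → y.1 i ≤ x.1 i := by
    intro i x y h
    have h1 := (e x).2
    have h2 : y.1 i * Fintype.card S < (x.1 i + 1) * Fintype.card S := by
      simp only [r] at h
      rw [add_mul, one_mul]
      omega
    exact Nat.lt_succ_iff.1 (lt_of_mul_lt_mul_right h2 (Nat.zero_le _))
  obtain ⟨σ, hσ⟩ := exists_colorful_dominant r (fun i x y h => by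
    have hxy : x.1 i = y.1 i := le_antisymm (hr i y x h.le) (hr i x y h.ge)
    simp only [r, hxy, Nat.add_left_cancel_iff] at h
    exact e.injective (Fin.ext h)) (fun x => c x.1)
  set C := σ.image (fun x => c x.1)
  have hne : σ.Nonempty := by
    obtain ⟨i, hi, -⟩ := hσ (Classical.arbitrary S)
    obtain ⟨x, hx, -⟩ := Finset.mem_image.1 hi
    exact ⟨x, hx⟩
  choose μ hμσ hμ using fun i => σ.exists_min_image (fun x => x.1 i) hne
  have hCcard : C.card ≤ Fintype.card I := Finset.card_le_univ _
  have hsum : N < ∑ i ∈ C, (μ i).1 i + C.card := by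
    by_contra! hle
    obtain ⟨i₂, hi₂, -⟩ := hσ (Classical.arbitrary S)
    let y : I → ℕ := fun i => (if i ∈ C then (μ i).1 i + 1 else 0) +
      if i = i₂ then N - (∑ i ∈ C, (μ i).1 i + C.card) else 0
    have hy : ∑ i, y i = N := by
      simp only [y, Finset.sum_add_distrib, Finset.sum_ite_mem, Finset.univ_inter,
        Finset.sum_ite_eq', Finset.mem_univ, if_true, Finset.sum_const, smul_eq_mul, mul_one]
      omega
    obtain ⟨i, hi, h⟩ := hσ ⟨y, (hS y).2 hy⟩
    have := hr _ _ _ (h _ (hμσ i))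
    simp only [y, if_pos hi] at this
    omega
  have hmono : ∀ (x : S) (D : Finset I), x ∈ σ → ∑ i ∈ D, (μ i).1 i ≤ ∑ i ∈ D, x.1 i :=
    fun x D hx => Finset.sum_le_sum fun i _ => hμ i x hx
  have hle : ∀ (x : S) (D : Finset I), ∑ i ∈ D, x.1 i ≤ N := fun x D =>
    ((hS _).1 x.2) ▸ Finset.sum_le_univ_sum_of_nonneg fun _ => Nat.zero_le _
  have hin : ∀ x ∈ σ, ∀ i ∈ C, x.1 i ≤ (μ i).1 i + Fintype.card I := by
    intro x hx i hi
    have h1 := hmono x (C.erase i) hx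
    have h2 := hle x C
    rw [← Finset.add_sum_erase C _ hi] at h2 hsum
    omega
  have hout : ∀ x ∈ σ, ∀ i, i ∉ C → x.1 i ≤ Fintype.card I := by
    intro x hx i hi
    have h1 := hmono x C hx
    have h2 := hle x (insert i C)
    rw [Finset.sum_insert hi] at h2
    omega
  have hclose : ∀ x ∈ σ, ∀ x' ∈ σ, ∀ j, x.1 j ≤ x'.1 j + Fintype.card I := by
    intro x hx x' hx' j
    by_cases hj : j ∈ C
    · exact (hin x hx j hj).trans (Nat.add_le_add_right (hμ j x' hx') _)
    · exact (hout x hx j hj).trans (Nat.le_add_left _ _)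
  obtain ⟨x, hx⟩ := hne
  refine ⟨x.1, (hS _).1 x.2, fun i => ?_⟩
  by_cases hi : i ∈ C
  · obtain ⟨x', hx', hc⟩ := Finset.mem_image.1 hi
    exact Or.inr ⟨x'.1, (hS _).1 x'.2, hc, fun j => ⟨hclose _ hx' _ hx j, hclose _ hx _ hx' j⟩⟩
  · exact Or.inl (hout x hx i hi)

/-- Brouwer's fixed point theorem for the standard simplex. -/
theorem exists_fixedPoint_stdSimplex {I : Type*} [Fintype I] [Nonempty I]
    {f : (I → ℝ) → I → ℝ} (hf : ContinuousOn f (stdSimplex ℝ I))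
    (hmaps : Set.MapsTo f (stdSimplex ℝ I) (stdSimplex ℝ I)) :
    ∃ p ∈ stdSimplex ℝ I, f p = p := by
  classical
  have hcol : ∀ p ∈ stdSimplex ℝ I, ∃ i, p i ≤ f p i := by
    intro p hp
    by_contra! h
    have := Finset.sum_lt_sum_of_nonempty Finset.univ_nonempty (fun i _ => h i)
    rw [hp.2, (hmaps hp).2] at this
    exact lt_irrefl _ this
  have happrox : ∀ k : ℕ, ∃ p ∈ stdSimplex ℝ I, ∀ i, ∃ q ∈ stdSimplex ℝ I,
      dist q p ≤ Fintype.card I / ((k : ℝ) + 1) ∧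
      q i ≤ f q i + Fintype.card I / ((k : ℝ) + 1) := by
    intro k
    let pt : (I → ℕ) → I → ℝ := fun x i => x i / ((k : ℝ) + 1)
    have hk : (0 : ℝ) < (k : ℝ) + 1 := by positivity
    have hpt : ∀ x : I → ℕ, ∑ i, x i = k + 1 → pt x ∈ stdSimplex ℝ I := by
      intro x hx
      refine ⟨fun i => by positivity, ?_⟩
      simp only [pt]
      rw [← Finset.sum_div, div_eq_one_iff_eq hk.ne']
      exact_mod_cast hx
    obtain ⟨x, hx, h⟩ := exists_lattice_point_near_colors (k + 1)
      (fun x => if hx : ∑ i, x i = k + 1 then (hcol _ (hpt x hx)).choose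
        else Classical.arbitrary I)
    refine ⟨pt x, hpt x hx, fun i => ?_⟩
    rcases h i with h | ⟨x', hx', hc, h⟩
    · refine ⟨pt x, hpt x hx, by rw [dist_self]; positivity, ?_⟩
      have h1 := (hmaps (hpt x hx)).1 i
      have h2 : pt x i ≤ Fintype.card I / ((k : ℝ) + 1) := by
        simp only [pt]
        gcongr
      linarith
    · refine ⟨pt x', hpt x' hx', ?_, ?_⟩
      · rw [dist_pi_le_iff (by positivity)]
        intro j
        obtain ⟨h1, h2⟩ := h j
        have h1' : (x' j : ℝ) ≤ x j + Fintype.card I := by exact_mod_cast h1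
        have h2' : (x j : ℝ) ≤ x' j + Fintype.card I := by exact_mod_cast h2
        simp only [pt]
        rw [Real.dist_eq, ← sub_div, abs_div, abs_of_pos hk]
        gcongr
        rw [abs_le]
        constructor <;> linarith
      · rw [dif_pos hx'] at hc
        have := (hcol _ (hpt x' hx')).choose_spec
        rw [hc] at this
        have : (0 : ℝ) ≤ Fintype.card I / ((k : ℝ) + 1) := by positivity
        linarith
  choose p hp q hq hqp hqf using happrox
  obtain ⟨a, ha, φ, hφ, hlim⟩ := (isCompact_stdSimplex ℝ I).tendsto_subseq hp
  have hd : Filter.Tendsto (fun k : ℕ => (Fintype.card I : ℝ) / ((φ k : ℝ) + 1))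
      Filter.atTop (nhds 0) := by
    have := (tendsto_one_div_add_atTop_nhds_zero_nat (𝕜 := ℝ)).const_mul (Fintype.card I : ℝ)
    simp only [mul_one_div, mul_zero] at this
    exact this.comp hφ.tendsto_atTop
  have hle : ∀ i, a i ≤ f a i := by
    intro i
    have hqlim : Filter.Tendsto (fun k => q (φ k) i) Filter.atTop (nhds a) := by
      refine hlim.congr_dist (squeeze_zero (fun _ => dist_nonneg) (fun k => ?_) hd)
      rw [dist_comm]
      exact hqp _ _
    have hflim : Filter.Tendsto (fun k => f (q (φ k) i)) Filter.atTop (nhds (f a)) :=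
      (hf a ha).tendsto.comp (tendsto_nhdsWithin_iff.2
        ⟨hqlim, Filter.Eventually.of_forall fun k => hq _ _⟩)
    have h1 := (continuous_apply i).continuousAt.tendsto.comp hqlim
    have h2 := ((continuous_apply i).continuousAt.tendsto.comp hflim).add hd
    rw [add_zero] at h2
    exact le_of_tendsto_of_tendsto' h1 h2 fun k => hqf _ _
  refine ⟨a, ha, funext fun i => ?_⟩
  exact ((Finset.sum_eq_sum_iff_of_le fun i _ => hle i).1
    (ha.2.trans (hmaps ha).2.symm) i (Finset.mem_univ i)).symm

theorem update_mem_univ_pi {ι : Type*} [DecidableEq ι] {E : ι → Type*} {C : ∀ i, Set (E i)}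
    {u : ∀ i, E i} (hu : u ∈ Set.univ.pi C) {i : ι} {x : E i} (hx : x ∈ C i) :
    Function.update u i x ∈ Set.univ.pi C := by
  intro j _
  by_cases hj : j = i
  · subst hj; simpa using hx
  · simpa [hj] using hu j trivial

/-- Approximate Nash equilibria with respect to finitely many deviations. -/
theorem exists_approx_nash {ι : Type*} [Fintype ι] [DecidableEq ι] {E : ι → Type*}
    [∀ i, NormedAddCommGroup (E i)] [∀ i, NormedSpace ℝ (E i)] {C : ∀ i, Set (E i)}
    (hCne : ∀ i, (C i).Nonempty) (hCcv : ∀ i, Convex ℝ (C i)) {K : ι → (∀ i, E i) → ℝ}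
    (hK : ∀ i, ContinuousOn (K i) (Set.univ.pi C))
    (hqc : ∀ i, ∀ u ∈ Set.univ.pi C,
      QuasiconcaveOn ℝ (C i) (fun v => K i (Function.update u i v)))
    (A : Finset (∀ i, E i)) (hA : ∀ v ∈ A, v ∈ Set.univ.pi C) {ε : ℝ} (hε : 0 < ε) :
    ∃ u ∈ Set.univ.pi C, ∀ i, ∀ v ∈ A, K i (Function.update u i (v i)) ≤ K i u + ε := by
  classical
  rcases A.eq_empty_or_nonempty with rfl | hAne
  · choose u hu using hCne
    exact ⟨u, fun i _ => hu i, by simp⟩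
  let G := Fintype.piFinset fun i => A.image fun v => v i
  have hGC : ∀ s ∈ G, s ∈ Set.univ.pi C := by
    intro s hs i _
    obtain ⟨v, hv, hvi⟩ := Finset.mem_image.1 (Fintype.mem_piFinset.1 hs i)
    exact hvi ▸ hA v hv i trivial
  have hAG : A ⊆ G := fun v hv => Fintype.mem_piFinset.2 fun i => Finset.mem_image_of_mem _ hv
  obtain ⟨v₀, hv₀⟩ := hAne
  have : Nonempty G := ⟨⟨v₀, hAG hv₀⟩⟩
  let pt : (G → ℝ) → ∀ i, E i := fun l => ∑ s, l s • s.1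
  have hpt : ∀ l ∈ stdSimplex ℝ G, pt l ∈ Set.univ.pi C := fun l hl =>
    (convex_pi fun i _ => hCcv i).sum_mem (fun s _ => hl.1 s) hl.2 fun s _ => hGC _ s.2
  have hptc : Continuous pt := by fun_prop
  let g : G → ι → (∀ i, E i) → (∀ i, E i) → ℝ := fun s i v u =>
    K i (Function.update u i (s.1 i)) - K i (Function.update u i (v i)) + ε
  let w : (∀ i, E i) → G → ℝ := fun u s => ∏ i, ∏ v ∈ A, max 0 (g s i v u)
  have hKc : ∀ i, ∀ s ∈ G,
      ContinuousOn (fun u => K i (Function.update u i (s i))) (Set.univ.pi C) := by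
    intro i s hs
    exact (hK i).comp (continuous_id.update i continuous_const).continuousOn
      fun u hu => update_mem_univ_pi hu (hGC s hs i trivial)
  have hwc : ∀ s, ContinuousOn (fun u => w u s) (Set.univ.pi C) := by
    intro s
    refine continuousOn_finsetProd _ fun i _ => continuousOn_finsetProd _ fun v hv => ?_
    exact continuousOn_const.sup (((hKc i _ s.2).sub (hKc i v (hAG hv))).add continuousOn_const)
  have hw0 : ∀ u s, 0 ≤ w u s := fun u s =>
    Finset.prod_nonneg fun i _ => Finset.prod_nonneg fun v _ => le_max_left _ _
  have hW : ∀ u, 0 < ∑ s, w u s := by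
    intro u
    choose b hbA hb using fun i =>
      A.exists_max_image (fun v => K i (Function.update u i (v i))) ⟨v₀, hv₀⟩
    refine Finset.sum_pos' (fun s _ => hw0 u s) ⟨⟨fun i => b i i, Fintype.mem_piFinset.2
      fun i => Finset.mem_image_of_mem (fun v => v i) (hbA i)⟩, Finset.mem_univ _, ?_⟩
    refine Finset.prod_pos fun i _ => Finset.prod_pos fun v hv => lt_max_of_lt_right ?_
    have := hb i v hv
    simp only [g]
    linarith
  let F : (G → ℝ) → G → ℝ := fun l s => w (pt l) s / ∑ t, w (pt l) t
  obtain ⟨l, hl, hfix⟩ := exists_fixedPoint_stdSimplex (f := F) (by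
      refine continuousOn_pi.2 fun s => ?_
      have hc : ∀ t, ContinuousOn (fun l => w (pt l) t) (stdSimplex ℝ G) := fun t =>
        (hwc t).comp hptc.continuousOn hpt
      exact (hc s).div (continuousOn_finsetSum _ fun t _ => hc t) fun l _ => (hW _).ne')
    (fun l _ => ⟨fun s => div_nonneg (hw0 _ _) (hW _).le, by
      simp only [F]
      rw [← Finset.sum_div, div_self (hW _).ne']⟩)
  refine ⟨pt l, hpt l hl, fun i v hv => ?_⟩
  have hmem : ∀ s : G, l s ≠ 0 → s.1 i ∈ {x | x ∈ C i ∧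
      K i (Function.update (pt l) i (v i)) - ε ≤ K i (Function.update (pt l) i x)} := by
    intro s hs
    refine ⟨hGC _ s.2 i trivial, ?_⟩
    rw [← hfix] at hs
    have h1 : w (pt l) s ≠ 0 := fun h => hs (by simp only [F, h, zero_div])
    have h2 := Finset.prod_ne_zero_iff.1 (Finset.prod_ne_zero_iff.1 h1 i (Finset.mem_univ i)) v hv
    by_contra! h
    refine h2 (max_eq_left ?_)
    simp only [g]
    linarith
  have hconv : pt l i ∈ {x | x ∈ C i ∧
      K i (Function.update (pt l) i (v i)) - ε ≤ K i (Function.update (pt l) i x)} := by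
    have hsum : ∑ s ∈ Finset.univ.filter (fun s => l s ≠ 0), l s = 1 := by
      rw [Finset.sum_filter_ne_zero]; exact hl.2
    have hpti : pt l i = ∑ s ∈ Finset.univ.filter (fun s => l s ≠ 0), l s • s.1 i := by
      rw [Finset.sum_filter_of_ne fun s _ h => left_ne_zero_of_smul h]
      simp [pt]
    rw [hpti]
    exact (hqc i (pt l) (hpt l hl) _).sum_mem (fun s _ => hl.1 s) hsum
      fun s hs => hmem s (Finset.mem_filter.1 hs).2
  have := hconv.2
  rw [Function.update_eq_self] at this
  linarith

/-- Nash's theorem for continuous payoffs which are quasiconcave in the own strategy. -/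
theorem exists_nash_of_quasiconcaveOn {ι : Type*} [Fintype ι] [DecidableEq ι] {E : ι → Type*}
    [∀ i, NormedAddCommGroup (E i)] [∀ i, NormedSpace ℝ (E i)] {C : ∀ i, Set (E i)}
    (hCne : ∀ i, (C i).Nonempty) (hCcp : ∀ i, IsCompact (C i)) (hCcv : ∀ i, Convex ℝ (C i))
    {K : ι → (∀ i, E i) → ℝ} (hK : ∀ i, ContinuousOn (K i) (Set.univ.pi C))
    (hqc : ∀ i, ∀ u ∈ Set.univ.pi C,
      QuasiconcaveOn ℝ (C i) (fun v => K i (Function.update u i v))) :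
    ∃ u ∈ Set.univ.pi C, ∀ i, ∀ v ∈ C i, K i (Function.update u i v) ≤ K i u := by
  classical
  have hcp : IsCompact (Set.univ.pi C) := isCompact_univ_pi hCcp
  let t : Set.univ.pi C × ℕ → Set (∀ i, E i) := fun a => ⋂ i, {u | u ∈ Set.univ.pi C ∧
    K i (Function.update u i (a.1.1 i)) ≤ K i u + 1 / ((a.2 : ℝ) + 1)}
  have ht : ∀ a, IsClosed (t a) := by
    intro a
    refine isClosed_iInter fun i => hcp.isClosed.isClosed_le ?_ ((hK i).add continuousOn_const)
    refine (hK i).comp (continuous_id.update i continuous_const).continuousOn fun u hu => ?_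
    exact update_mem_univ_pi hu (a.1.2 i trivial)
  obtain ⟨u, hu, hut⟩ := hcp.inter_iInter_nonempty t ht (by
    intro s
    obtain ⟨M, hM⟩ := (s.image Prod.snd).exists_le
    obtain ⟨u, hu, h⟩ := exists_approx_nash hCne hCcv hK hqc (s.image fun a => a.1.1) (by
      intro v hv
      obtain ⟨a, -, rfl⟩ := Finset.mem_image.1 hv
      exact a.1.2) (ε := 1 / ((M : ℝ) + 1)) (by positivity)
    refine ⟨u, hu, Set.mem_iInter₂.2 fun a ha => Set.mem_iInter.2 fun i => ⟨hu, ?_⟩⟩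
    refine (h i _ (Finset.mem_image_of_mem _ ha)).trans ?_
    have : (a.2 : ℝ) ≤ M := by exact_mod_cast hM _ (Finset.mem_image_of_mem _ ha)
    gcongr)
  refine ⟨u, hu, fun i v hv => ?_⟩
  have hmem : Function.update u i v ∈ Set.univ.pi C := update_mem_univ_pi hu hv
  have hlim := (tendsto_one_div_add_atTop_nhds_zero_nat (𝕜 := ℝ)).const_add (K i u)
  rw [add_zero] at hlim
  refine ge_of_tendsto' hlim fun k => ?_
  have := (Set.mem_iInter.1 (Set.mem_iInter.1 hut (⟨_, hmem⟩, k)) i).2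
  simpa using this


/-- Under compactness, convexity and quasiconcavity assumptions,
for `K_i u = min_{u₀ ∈ P₀} J_i u₀ u` there is a profile `u♮` (with `u♮ i ∈ C i`)
such that `K_i u♮ ≥ K_i (v, u♮_{-i})` for all `i` and `v ∈ C i`; consequently
`(u₀, u♮) ∈ B` for every `u₀ ∈ P₀`, and in particular `B` is nonempty. -/
theorem exists_nash_of_K_and_B_nonempty
    {n : ℕ} {P₀ : Type*} {E : Fin n → Type*}
    [TopologicalSpace P₀] [CompactSpace P₀] [Nonempty P₀]
    [∀ i, NormedAddCommGroup (E i)] [∀ i, NormedSpace ℝ (E i)]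
    [∀ i, FiniteDimensional ℝ (E i)]
    (C : ∀ i, Set (E i))
    (hCne : ∀ i, (C i).Nonempty) (hCcp : ∀ i, IsCompact (C i))
    (hCcv : ∀ i, Convex ℝ (C i))
    (J₀ : P₀ → (∀ i, E i) → ℝ) (J : Fin n → P₀ → (∀ i, E i) → ℝ)
    -- continuity of the payoffs on `P₀ × P`:
    (hJ₀ : ContinuousOn (fun p : P₀ × (∀ i, E i) => J₀ p.1 p.2)
      (Set.univ ×ˢ Set.univ.pi C))
    (hJ : ∀ i, ContinuousOn (fun p : P₀ × (∀ i, E i) => J i p.1 p.2)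
      (Set.univ ×ˢ Set.univ.pi C))
    -- quasiconcavity of `v ↦ J_i u₀ (v, u_{-i})` on `C i`:
    (hqc : ∀ (u₀ : P₀) (i : Fin n) (u : ∀ j, E j), (∀ j, u j ∈ C j) →
      QuasiconcaveOn ℝ (C i) (fun v => J i u₀ (Function.update u i v)))
    -- `K_i u = min_{u₀ ∈ P₀} J_i u₀ u`:
    (K : Fin n → (∀ i, E i) → ℝ)
    (hK : ∀ i u, K i u = ⨅ u₀ : P₀, J i u₀ u) :
    ∃ us : ∀ i, E i,
      (∀ i, us i ∈ C i) ∧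
      -- `u♮` is a Nash equilibrium for the payoffs `K_i`:
      (∀ i, ∀ v ∈ C i, K i (Function.update us i v) ≤ K i us) ∧
      -- `(u₀, u♮) ∈ B` for every `u₀`:
      (∀ u₀ : P₀, ∀ i,
        (⨆ v : C i, ⨅ w : P₀, J i w (Function.update us i (v : E i))) ≤ J i u₀ us) ∧
      -- in particular `B` is nonempty:
      {p : P₀ × (∀ i, E i) | (∀ j, p.2 j ∈ C j) ∧
        ∀ i, (⨆ v : C i, ⨅ w : P₀, J i w (Function.update p.2 i (v : E i)))
          ≤ J i p.1 p.2}.Nonempty := by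
  have hbdd : ∀ i, ∀ u ∈ Set.univ.pi C, BddBelow (Set.range fun w : P₀ => J i w u) := by
    intro i u hu
    have hc : Continuous fun w : P₀ => J i w u :=
      (hJ i).comp_continuous (f := fun w => (w, u)) (by fun_prop) fun w => ⟨trivial, hu⟩
    exact (isCompact_range hc).bddBelow
  have hKc : ∀ i, ContinuousOn (K i) (Set.univ.pi C) := by
    intro i
    rw [continuousOn_iff_continuous_domRestrict]
    have hc : Continuous fun p : Set.univ.pi C × P₀ => J i p.2 p.1 :=
      (hJ i).comp_continuous (f := fun p : Set.univ.pi C × P₀ => (p.2, p.1.1)) (by fun_prop)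
        fun p => ⟨trivial, p.1.2⟩
    have := isCompact_univ.continuous_sInf
      (f := fun (u : Set.univ.pi C) (w : P₀) => J i w u) hc
    refine this.congr fun u => ?_
    rw [Set.image_univ, Set.domRestrict_apply, hK]
    rfl
  have hqK : ∀ i, ∀ u ∈ Set.univ.pi C,
      QuasiconcaveOn ℝ (C i) (fun v => K i (Function.update u i v)) := by
    intro i u hu c
    have heq : {v | v ∈ C i ∧ c ≤ K i (Function.update u i v)} =
        ⋂ w : P₀, {v | v ∈ C i ∧ c ≤ J i w (Function.update u i v)} := by
      ext v
      simp only [Set.mem_iInter, Set.mem_ofPred_eq, hK]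
      constructor
      · rintro ⟨hv, h⟩ w
        exact ⟨hv, h.trans (ciInf_le (hbdd i _ (update_mem_univ_pi hu hv)) w)⟩
      · intro h
        exact ⟨(h (Classical.arbitrary P₀)).1, le_ciInf fun w => (h w).2⟩
    rw [heq]
    exact convex_iInter fun w => hqc w i u (fun j => hu j trivial) c
  obtain ⟨us, hus, hnash⟩ := exists_nash_of_quasiconcaveOn hCne hCcp hCcv hKc hqK
  have hB : ∀ u₀ : P₀, ∀ i,
      (⨆ v : C i, ⨅ w : P₀, J i w (Function.update us i (v : E i))) ≤ J i u₀ us := by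
    intro u₀ i
    have : Nonempty (C i) := (hCne i).to_subtype
    refine ciSup_le fun v => ?_
    rw [← hK]
    refine (hnash i v v.2).trans ?_
    rw [hK]
    exact ciInf_le (hbdd i us hus) u₀
  exact ⟨us, fun i => hus i trivial, hnash, hB,
    (Classical.arbitrary P₀, us), fun i => hus i trivial, hB _⟩
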